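/- For any execution step P : C →_A C', the number of bad nodes does not increase: |B'| ≤ |B|. -/

import Mathlib

open scoped Classical

/-- A pre-configuration: a finite node set `V` with a partial parent map
(`none` means the node has no parent) and an integer height assignment. -/
structure PreConfig (V : Type*) where
  parent : V → Option V
  height : V → ℤ

namespace PreConfig

variable {V : Type*} [Fintype V] [LinearOrder V]

/-- The children of `u` are the nodes whose parent is `u`. -/
noncomputable def children (C : PreConfig V) (u : V) : Finset V :=
  Finset.univ.filter (fun v => C.parent v = some u)

/-- A leaf is a node with no children. -/
def IsLeaf (C : PreConfig V) (u : V) : Prop := C.children u = ∅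

/-- Maximum height value among the children of `u` (junk value `0` for a leaf). -/
noncomputable def maxH (C : PreConfig V) (u : V) : ℤ :=
  if h : (C.children u).Nonempty then (C.children u).sup' h C.height else 0

/-- Minimum height value among the children of `u` (junk value `0` for a leaf). -/
noncomputable def minH (C : PreConfig V) (u : V) : ℤ :=
  if h : (C.children u).Nonempty then (C.children u).inf' h C.height else 0

/-- A child of `u` of maximum height value; ties broken by a fixed rule
(smallest ID). Junk value `u` for a leaf. -/
noncomputable def maxChild (C : PreConfig V) (u : V) : V :=
  if h : ((C.children u).filter fun v => C.height v = C.maxH u).Nonempty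
  then ((C.children u).filter fun v => C.height v = C.maxH u).min' h else u

/-- A child of `u` of minimum height value; ties broken by a fixed rule
(smallest ID). Junk value `u` for a leaf. -/
noncomputable def minChild (C : PreConfig V) (u : V) : V :=
  if h : ((C.children u).filter fun v => C.height v = C.minH u).Nonempty
  then ((C.children u).filter fun v => C.height v = C.minH u).min' h else u

/-- `stable(u)`: `h(u) = 0` if `u` is a leaf, and `h(u) = 1 + max_{w child of u} h(w)` otherwise. -/
def Stable (C : PreConfig V) (u : V) : Prop :=
  (C.IsLeaf u ∧ C.height u = 0) ∨ (¬ C.IsLeaf u ∧ C.height u = 1 + C.maxH u)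

/-- `balanced(u)`: `|h(z) − h(z')| ≤ α` for all children `z, z'` of `u`. -/
def Balanced (α : ℤ) (C : PreConfig V) (u : V) : Prop :=
  ∀ z ∈ C.children u, ∀ z' ∈ C.children u, |C.height z - C.height z'| ≤ α

/-- `u` is enabled for a height update iff `¬stable(u)`. -/
def UpdateEnabled (C : PreConfig V) (u : V) : Prop := ¬ C.Stable u

/-- `u` is enabled for a swap iff `stable(u) ∧ stable(max(u)) ∧ ¬balanced(u)`. -/
def SwapEnabled (α : ℤ) (C : PreConfig V) (u : V) : Prop :=
  C.Stable u ∧ C.Stable (C.maxChild u) ∧ ¬ Balanced α C u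

/-- `u` is enabled iff it is enabled for a height update or for a swap. -/
def Enabled (α : ℤ) (C : PreConfig V) (u : V) : Prop :=
  C.UpdateEnabled u ∨ SwapEnabled α C u

/-- The value written by a height update: `0` for a leaf, `1 + max_{w child of u} h(w)` otherwise. -/
noncomputable def newHeight (C : PreConfig V) (u : V) : ℤ :=
  if C.IsLeaf u then 0 else 1 + C.maxH u

/-- A bad node: an internal node `u` with `h(u) ≤ max_{v child of u} h(v)`,
or a leaf `u` with `h(u) < 0`. -/
def Bad (C : PreConfig V) (u : V) : Prop :=
  (¬ C.IsLeaf u ∧ C.height u ≤ C.maxH u) ∨ (C.IsLeaf u ∧ C.height u < 0)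

/-- `v` reaches `a` by iterating the parent map. -/
def Reaches (C : PreConfig V) (v a : V) : Prop :=
  Relation.ReflTransGen (fun x y => C.parent x = some y) v a

/-- The underlying graph is a rooted tree with root `r`: `r` has no parent,
every other node has a (unique) parent, and every node reaches `r` by
iterating the parent map. -/
def IsTree (C : PreConfig V) (r : V) : Prop :=
  C.parent r = none ∧ (∀ v, C.parent v = none → v = r) ∧ ∀ v, C.Reaches v r

/-- The subtree `S_u` of `u`: the set of descendants of `u` (including `u`). -/
def subtree (C : PreConfig V) (u : V) : Set V := {v | C.Reaches v u}

/-- The actual height `h*(u)` of `u`: the length of a longest directed path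
going downward from `u` (such a maximal path necessarily ends at a leaf of `S_u`). -/
noncomputable def hstar (C : PreConfig V) (u : V) : ℕ :=
  sSup {n : ℕ | ∃ f : ℕ → V, f 0 = u ∧ ∀ i < n, C.parent (f (i + 1)) = some (f i)}

/-- An execution step `C →_A C'`: a nonempty set `A` of nodes enabled in `C` is
activated simultaneously; each `u ∈ A` enabled for a height update sets its height
to `newHeight`; each `u ∈ A` enabled for a swap replaces the edges `(u, min(u))` and
`(max(u), max(max(u)))` by `(u, max(max(u)))` and `(max(u), min(u))` (all guards and
functions evaluated in `C`); everything else is unchanged. -/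
structure Step (α : ℤ) (C C' : PreConfig V) (A : Finset V) : Prop where
  nonempty : A.Nonempty
  all_enabled : ∀ u ∈ A, Enabled α C u
  height_update : ∀ u ∈ A, C.UpdateEnabled u → C'.height u = C.newHeight u
  height_keep : ∀ u, ¬ (u ∈ A ∧ C.UpdateEnabled u) → C'.height u = C.height u
  swap_out : ∀ u ∈ A, SwapEnabled α C u → C'.parent (C.minChild u) = some (C.maxChild u)
  swap_in : ∀ u ∈ A, SwapEnabled α C u → C'.parent (C.maxChild (C.maxChild u)) = some u
  parent_keep : ∀ v, (∀ u ∈ A, SwapEnabled α C u →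
      v ≠ C.minChild u ∧ v ≠ C.maxChild (C.maxChild u)) → C'.parent v = C.parent v

end PreConfig

namespace PreConfig

variable {V : Type*} [Fintype V] [LinearOrder V]

theorem mem_children {C : PreConfig V} {u v : V} : v ∈ C.children u ↔ C.parent v = some u := by
  simp [children]

theorem not_isLeaf_of_parent {C : PreConfig V} {u v : V} (h : C.parent v = some u) :
    ¬ C.IsLeaf u := fun hl => by
  have := mem_children.2 h
  rw [IsLeaf] at hl
  simp [hl] at this

theorem exists_parent_of_not_isLeaf {C : PreConfig V} {u : V} (h : ¬ C.IsLeaf u) :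
    ∃ v, C.parent v = some u := by
  obtain ⟨v, hv⟩ := Finset.nonempty_iff_ne_empty.2 h
  exact ⟨v, mem_children.1 hv⟩

theorem height_le_maxH {C : PreConfig V} {u v : V} (h : C.parent v = some u) :
    C.height v ≤ C.maxH u := by
  have hv := mem_children.2 h
  rw [maxH, dif_pos ⟨v, hv⟩]
  exact Finset.le_sup' _ hv

theorem minH_le_height {C : PreConfig V} {u v : V} (h : C.parent v = some u) :
    C.minH u ≤ C.height v := by
  have hv := mem_children.2 h
  rw [minH, dif_pos ⟨v, hv⟩]
  exact Finset.inf'_le _ hv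

theorem exists_height_eq_maxH {C : PreConfig V} {u : V} (h : ¬ C.IsLeaf u) :
    ∃ v, C.parent v = some u ∧ C.height v = C.maxH u := by
  have hne := Finset.nonempty_iff_ne_empty.2 h
  obtain ⟨v, hv, hv'⟩ := Finset.exists_mem_eq_sup' hne C.height
  exact ⟨v, mem_children.1 hv, by rw [maxH, dif_pos hne, hv']⟩

theorem exists_height_eq_minH {C : PreConfig V} {u : V} (h : ¬ C.IsLeaf u) :
    ∃ v, C.parent v = some u ∧ C.height v = C.minH u := by
  have hne := Finset.nonempty_iff_ne_empty.2 h
  obtain ⟨v, hv, hv'⟩ := Finset.exists_mem_eq_inf' hne C.height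
  exact ⟨v, mem_children.1 hv, by rw [minH, dif_pos hne, hv']⟩

theorem maxChild_spec {C : PreConfig V} {u : V} (h : ¬ C.IsLeaf u) :
    C.parent (C.maxChild u) = some u ∧ C.height (C.maxChild u) = C.maxH u := by
  obtain ⟨v, hv, hv'⟩ := exists_height_eq_maxH h
  have hne : ((C.children u).filter fun v => C.height v = C.maxH u).Nonempty :=
    ⟨v, Finset.mem_filter.2 ⟨mem_children.2 hv, hv'⟩⟩
  have hmem := Finset.mem_filter.1 (Finset.min'_mem _ hne)
  rw [maxChild, dif_pos hne]
  exact ⟨mem_children.1 hmem.1, hmem.2⟩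

theorem minChild_spec {C : PreConfig V} {u : V} (h : ¬ C.IsLeaf u) :
    C.parent (C.minChild u) = some u ∧ C.height (C.minChild u) = C.minH u := by
  obtain ⟨v, hv, hv'⟩ := exists_height_eq_minH h
  have hne : ((C.children u).filter fun v => C.height v = C.minH u).Nonempty :=
    ⟨v, Finset.mem_filter.2 ⟨mem_children.2 hv, hv'⟩⟩
  have hmem := Finset.mem_filter.1 (Finset.min'_mem _ hne)
  rw [minChild, dif_pos hne]
  exact ⟨mem_children.1 hmem.1, hmem.2⟩

theorem maxChild_of_isLeaf {C : PreConfig V} {u : V} (h : C.IsLeaf u) : C.maxChild u = u := by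
  rw [IsLeaf] at h
  simp [maxChild, h]

theorem Stable.height_lt {C : PreConfig V} {u v : V} (hu : C.Stable u)
    (h : C.parent v = some u) : C.height v < C.height u := by
  have := height_le_maxH h
  rcases hu with hu | hu
  · exact absurd hu.1 (not_isLeaf_of_parent h)
  · omega

theorem height_maxChild_le_of_stable {C : PreConfig V} {u : V} (hu : C.Stable u) :
    C.height (C.maxChild u) ≤ C.height u := by
  by_cases hl : C.IsLeaf u
  · rw [maxChild_of_isLeaf hl]
  · exact (hu.height_lt (maxChild_spec hl).1).le

theorem SwapEnabled.not_isLeaf {α : ℤ} {C : PreConfig V} {u : V} (h : SwapEnabled α C u) :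
    ¬ C.IsLeaf u := fun hl => h.2.2 fun z hz => by
  rw [IsLeaf] at hl
  simp [hl] at hz

theorem SwapEnabled.height_minChild_lt {α : ℤ} (hα : 0 ≤ α) {C : PreConfig V} {u : V}
    (h : SwapEnabled α C u) : C.height (C.minChild u) < C.height (C.maxChild u) := by
  rw [(minChild_spec h.not_isLeaf).2, (maxChild_spec h.not_isLeaf).2]
  by_contra hle
  refine h.2.2 fun z hz z' hz' => ?_
  have h₁ := height_le_maxH (mem_children.1 hz)
  have h₂ := height_le_maxH (mem_children.1 hz')
  have h₃ := minH_le_height (mem_children.1 hz)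
  have h₄ := minH_le_height (mem_children.1 hz')
  rw [abs_le]
  omega

namespace Step

variable {α : ℤ} {C C' : PreConfig V} {A : Finset V}

theorem parent_cases (hs : Step α C C' A) (v : V) :
    C'.parent v = C.parent v ∨ ∃ u ∈ A, SwapEnabled α C u ∧
      (v = C.minChild u ∨ v = C.maxChild (C.maxChild u)) := by
  by_contra! h
  exact h.1 (hs.parent_keep v h.2)

/-- Only bad nodes increase their height. -/
theorem bad_of_height_lt (hs : Step α C C' A) {v : V} (h : C.height v < C'.height v) :
    (v ∈ A ∧ C.UpdateEnabled v) ∧ C.Bad v := by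
  have hu : v ∈ A ∧ C.UpdateEnabled v := by
    by_contra hu
    exact h.ne' (hs.height_keep v hu)
  refine ⟨hu, ?_⟩
  rw [hs.height_update v hu.1 hu.2, newHeight] at h
  split_ifs at h with hl
  · exact Or.inr ⟨hl, h⟩
  · exact Or.inl ⟨hl, by omega⟩

/-- If `w` was good or is updated in the step, then the previous height of each of its new
children is smaller than the new height of `w`. -/
theorem height_lt_of_parent (hα : 0 ≤ α) (hs : Step α C C' A) {w c : V}
    (hw : ¬ C.Bad w ∨ (w ∈ A ∧ C.UpdateEnabled w)) (hc : C'.parent c = some w) :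
    C.height c < C'.height w := by
  rcases hs.parent_cases c with hk | ⟨u, huA, hu, rfl | rfl⟩
  · rw [hk] at hc
    have hle := height_le_maxH hc
    have hl := not_isLeaf_of_parent hc
    by_cases hU : w ∈ A ∧ C.UpdateEnabled w
    · rw [hs.height_update w hU.1 hU.2, newHeight, if_neg hl]
      omega
    · rw [hs.height_keep w hU]
      by_contra hlt
      exact hw.resolve_right hU (Or.inl ⟨hl, by omega⟩)
  · obtain rfl : C.maxChild u = w := Option.some.inj ((hs.swap_out u huA hu).symm.trans hc)
    rw [hs.height_keep _ fun hU => hU.2 hu.2.1]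
    exact hu.height_minChild_lt hα
  · obtain rfl : u = w := Option.some.inj ((hs.swap_in u huA hu).symm.trans hc)
    rw [hs.height_keep _ fun hU => hU.2 hu.1]
    exact (height_maxChild_le_of_stable hu.2.1).trans_lt
      (hu.1.height_lt (maxChild_spec hu.not_isLeaf).1)

/-- An internal node stays internal. -/
theorem not_isLeaf (hs : Step α C C' A) {w : V} (hw : ¬ C.IsLeaf w) : ¬ C'.IsLeaf w := by
  obtain ⟨c, hc⟩ := exists_parent_of_not_isLeaf hw
  rcases hs.parent_cases c with hk | ⟨u, huA, hu, rfl | rfl⟩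
  · exact not_isLeaf_of_parent (hk.trans hc)
  · obtain rfl : u = w :=
      Option.some.inj ((minChild_spec hu.not_isLeaf).1.symm.trans hc)
    exact not_isLeaf_of_parent (hs.swap_in u huA hu)
  · by_cases hl : C.IsLeaf (C.maxChild u)
    · rw [maxChild_of_isLeaf hl] at hc
      obtain rfl : u = w :=
        Option.some.inj ((maxChild_spec hu.not_isLeaf).1.symm.trans hc)
      exact not_isLeaf_of_parent (hs.swap_in u huA hu)
    · obtain rfl : C.maxChild u = w := Option.some.inj ((maxChild_spec hl).1.symm.trans hc)
      exact not_isLeaf_of_parent (hs.swap_out u huA hu)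

theorem exists_bad_child (hα : 0 ≤ α) (hs : Step α C C' A) {w : V} (hw' : C'.Bad w)
    (hw : ¬ C.Bad w ∨ (w ∈ A ∧ C.UpdateEnabled w)) :
    ∃ c, C'.parent c = some w ∧ (c ∈ A ∧ C.UpdateEnabled c) ∧ C.Bad c := by
  rcases hw' with ⟨hl', hle⟩ | ⟨hl', hneg⟩
  · obtain ⟨c, hc, hmax⟩ := exists_height_eq_maxH hl'
    have := hs.height_lt_of_parent hα hw hc
    exact ⟨c, hc, hs.bad_of_height_lt (by omega)⟩
  · have hl : C.IsLeaf w := by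
      by_contra hl
      exact hs.not_isLeaf hl hl'
    by_cases hU : w ∈ A ∧ C.UpdateEnabled w
    · simp [hs.height_update w hU.1 hU.2, newHeight, hl] at hneg
    · rw [hs.height_keep w hU] at hneg
      exact absurd (Or.inr ⟨hl, hneg⟩) (hw.resolve_right hU)

end Step

end PreConfig

/-- For any execution step `C →_A C'`, the number of bad nodes does
not increase: `|B'| ≤ |B|`. -/
theorem stmt15 {V : Type*} [Fintype V] [LinearOrder V] (α : ℤ) (hα : 1 ≤ α)
    (C C' : PreConfig V) (A : Finset V) (r : V)
    (hT : C.IsTree r) (hstep : PreConfig.Step α C C' A) :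
    {u | C'.Bad u}.ncard ≤ {u | C.Bad u}.ncard := by
  have hex : ∀ w, C'.Bad w → ∃ c, C.Bad c ∧
      ((c = w ∧ ¬ (w ∈ A ∧ C.UpdateEnabled w)) ∨
        (C'.parent c = some w ∧ c ∈ A ∧ C.UpdateEnabled c)) := by
    intro w hw'
    by_cases hw : ¬ C.Bad w ∨ (w ∈ A ∧ C.UpdateEnabled w)
    · obtain ⟨c, hc, hU, hb⟩ := hstep.exists_bad_child (by omega) hw' hw
      exact ⟨c, hb, Or.inr ⟨hc, hU⟩⟩
    · rw [not_or, not_not] at hw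
      exact ⟨w, hw.1, Or.inl ⟨rfl, hw.2⟩⟩
  choose f hf hf' using hex
  refine Set.ncard_le_ncard_of_injOn (fun w => if h : C'.Bad w then f w h else w) ?_ ?_
    (Set.toFinite _)
  · intro w hw
    have hw : C'.Bad w := hw
    simpa [hw] using hf w hw
  · intro w hw x hx hwx
    have hw : C'.Bad w := hw
    have hx : C'.Bad x := hx
    simp only [hw, hx, dite_true] at hwx
    rcases hf' w hw with ⟨h₁, h₂⟩ | ⟨h₁, h₂⟩ <;> rcases hf' x hx with ⟨h₃, h₄⟩ | ⟨h₃, h₄⟩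
    · rw [← h₁, hwx, h₃]
    · rw [← hwx, h₁] at h₄
      exact absurd h₄ h₂
    · rw [hwx, h₃] at h₂
      exact absurd h₂ h₄
    · rw [hwx] at h₁
      exact Option.some.inj (h₁.symm.trans h₃)
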